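/- Let W₀ be a real n × m matrix, and let A be a diagonal real n × n matrix and B a diagonal real m × m matrix. Then the update matrix ΔW = A·W₀·B − W₀ satisfies rank(ΔW) ≤ min(2·rank(W₀), n, m). -/

import Mathlib

theorem rank_sub_le_aux {n m : ℕ} (X Y : Matrix (Fin n) (Fin m) ℝ) :
    (X - Y).rank ≤ X.rank + Y.rank := by
  unfold Matrix.rank
  refine le_trans (Submodule.finrank_mono ?_)
    (Submodule.finrank_add_le_finrank_add_finrank
      (LinearMap.range X.mulVecLin) (LinearMap.range Y.mulVecLin))
  rintro _ ⟨v, rfl⟩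
  rw [Matrix.mulVecLin_apply, Matrix.sub_mulVec]
  exact Submodule.sub_mem _
    (Submodule.mem_sup_left ⟨v, rfl⟩) (Submodule.mem_sup_right ⟨v, rfl⟩)

theorem stmt_0 (n m : ℕ) (W₀ : Matrix (Fin n) (Fin m) ℝ)
    (A : Matrix (Fin n) (Fin n) ℝ) (B : Matrix (Fin m) (Fin m) ℝ)
    (hA : A.IsDiag) (hB : B.IsDiag) :
    (A * W₀ * B - W₀).rank ≤ min (2 * W₀.rank) (min n m) := by
  refine le_min ?_ (le_min (Matrix.rank_le_height _) (Matrix.rank_le_width _))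
  have h1 := rank_sub_le_aux (A * W₀ * B) W₀
  have h2 := Matrix.rank_mul_le_left (A * W₀) B
  have h3 := Matrix.rank_mul_le_right A W₀
  omega
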